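/- Let k ≥ 1, m, r be natural numbers and C : Fin m → Finset (Fin k) with (C(j)).card = r for all j, and assume there exists Q : Finset (Fin m) with Q.biUnion C = univ. For i ∈ Fin k set T(i) = {j : i ∈ C(j)}. Then the minimum, over all S : Finset (Fin m) such that (T(i) ∩ S) is nonempty for every i, of ∑_{i ∈ Fin k} (T(i) ∩ S).card, equals r times the minimum cardinality of a set cover, i.e., r · min{Q.card : Q.biUnion C = univ}. -/

import Mathlib

/-- **The simplified optimal bidding problem equals r times the optimal set cover.** For an
r-regular set-cover instance (every `C j` has cardinality `r`) admitting a set cover, with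
`T i = {j : i ∈ C j}`, the minimum over winning item-sets `S` (those intersecting every `T i`)
of `∑ i |T i ∩ S|` equals `r` times the minimum cardinality of a set cover. -/
theorem simplified_bidding_eq_setcover (k m r : ℕ) (hk : 1 ≤ k)
    (C : Fin m → Finset (Fin k)) (hC : ∀ j, (C j).card = r)
    (hcover : ∃ Q : Finset (Fin m), Q.biUnion C = Finset.univ) :
    sInf {x : ℕ | ∃ S : Finset (Fin m),
        (∀ i : Fin k, ((Finset.univ.filter (fun j => i ∈ C j)) ∩ S).Nonempty) ∧
          x = ∑ i : Fin k, ((Finset.univ.filter (fun j => i ∈ C j)) ∩ S).card}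
      = r * sInf {x : ℕ | ∃ Q : Finset (Fin m), Q.biUnion C = Finset.univ ∧ x = Q.card} := by
  have hsum : ∀ S : Finset (Fin m),
      ∑ i : Fin k, ((Finset.univ.filter (fun j => i ∈ C j)) ∩ S).card = r * S.card := by
    intro S
    have h1 : ∀ i : Fin k, ((Finset.univ.filter (fun j => i ∈ C j)) ∩ S).card
        = ∑ j ∈ S, if i ∈ C j then 1 else 0 := by
      intro i
      rw [← Finset.card_filter]
      congr 1
      ext j
      simp [and_comm]
    rw [Finset.sum_congr rfl (fun i _ => h1 i), Finset.sum_comm]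
    have h2 : ∀ j ∈ S, (∑ i : Fin k, if i ∈ C j then 1 else 0) = r := by
      intro j _
      rw [← hC j]
      simp
    rw [Finset.sum_congr rfl h2]
    simp [mul_comm]
  have hwin : ∀ S : Finset (Fin m),
      (∀ i : Fin k, ((Finset.univ.filter (fun j => i ∈ C j)) ∩ S).Nonempty) ↔
        S.biUnion C = Finset.univ := by
    intro S
    rw [Finset.eq_univ_iff_forall]
    refine forall_congr' fun i => ?_
    simp [Finset.Nonempty, and_comm]
  simp only [hsum, hwin]
  obtain ⟨Q₀, hQ₀⟩ := hcover
  have hne : {x : ℕ | ∃ Q : Finset (Fin m), Q.biUnion C = Finset.univ ∧ x = Q.card}.Nonempty :=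
    ⟨_, Q₀, hQ₀, rfl⟩
  apply le_antisymm
  · obtain ⟨Q, hQ, hx⟩ := Nat.sInf_mem hne
    rw [hx]
    exact Nat.sInf_le ⟨Q, hQ, rfl⟩
  · refine le_csInf ⟨_, Q₀, hQ₀, rfl⟩ ?_
    rintro x ⟨Q, hQ, rfl⟩
    exact Nat.mul_le_mul_left r (Nat.sInf_le ⟨Q, hQ, rfl⟩)
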